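/- arXiv:2408.00643 — 5 statements merged into one kernel-verified Lean document; each statement's English description precedes it below -/
import Mathlib

section
/- The ℤ-module Λ is an even lattice containing W with finite index (⟨u,v⟩ ∈ ℤ and ⟨u,u⟩ ∈ 2ℤ for all u,v ∈ Λ), Λ equals its own dual lattice {y ∈ V : ⟨y,u⟩ ∈ ℤ for all u ∈ Λ} (so Λ is unimodular, hence an even unimodular lattice of signature (3,19), isometric to the K3 lattice), and τ(Λ) = Λ and φ(Λ) = Λ. -/
/- Context: V = ℚ^22 with the Gram matrix of the paper, W = ℤ^22,
τ and φ the involutions of the symplectic (ℤ/2ℤ)²-action,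
and Λ ≃ Λ_K3 the overlattice of W generated by the standard basis together
with the seven vectors α,β,γ,δ,ε,ζ,η. -/

noncomputable section
open Matrix

abbrev V : Type := Fin 22 → ℚ

def gramX : Matrix (Fin 22) (Fin 22) ℚ := Matrix.of fun i j =>
  if i = j then
    (if i.val < 16 then -2 else if i.val < 18 then -4 else if i.val < 20 then 0 else 4)
  else if i.val / 2 = j.val / 2 then
    (if i.val < 16 then 1 else if i.val < 18 then 2 else if i.val < 20 then 3 else 2)
  else 0

def B (u v : V) : ℚ := u ⬝ᵥ (gramX *ᵥ v)

def tauIdx : Fin 22 → Fin 22 :=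
  ![2,3,0,1,6,7,4,5,8,9,10,11,14,15,12,13,16,17,18,19,20,21]

def tauSign : Fin 22 → ℚ :=
  ![1,1,1,1,1,1,1,1,1,1,1,1,1,1,1,1,-1,-1,1,1,1,1]

def tau : V → V := fun u i => tauSign i * u (tauIdx i)

def phiIdx : Fin 22 → Fin 22 :=
  ![6,7,4,5,2,3,0,1,10,11,8,9,14,15,12,13,16,17,18,19,20,21]

def phi : V → V := fun u i => u (phiIdx i)

def W : Set V := {u | ∀ i, ∃ n : ℤ, u i = (n : ℚ)}

/-- standard basis vectors -/
def bv : Fin 22 → V := fun i j => if i = j then 1 else 0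

def vα : V := (1/3 : ℚ) •
  (-(bv 0) + bv 1 + bv 6 - bv 7 - bv 8 + bv 9 + bv 10 - bv 11 - bv 12 + bv 13 + bv 14 - bv 15)
def vβ : V := (1/3 : ℚ) •
  (-(bv 2) + bv 3 + bv 4 - bv 5 - bv 8 + bv 9 + bv 10 - bv 11 + bv 12 - bv 13 - bv 14 + bv 15)
def vγ : V := (1/3 : ℚ) • (bv 18 - bv 19 - bv 8 + bv 9 - bv 10 + bv 11)
def vδ : V := (1/3 : ℚ) • (bv 18 - bv 4 + bv 5 - bv 6 + bv 7 - bv 8 + bv 9)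
def vε : V := (1/3 : ℚ) •
  (bv 18 - bv 16 + bv 17 + bv 4 - bv 5 - bv 8 + bv 9 - bv 12 + bv 13 + bv 14 - bv 15)
def vζ : V := (1/2 : ℚ) •
  (bv 18 + bv 16 + bv 4 + bv 5 + bv 8 + bv 9 + bv 12 + bv 13 + bv 14 + bv 15 + vε)
  + (1/2 : ℚ) • bv 21
def vη : V := (1/2 : ℚ) • (bv 18 + bv 4 + bv 5 + bv 8 + bv 9 + vε)
  + (1/6 : ℚ) • (bv 12 - bv 13 + bv 14 - bv 15) + (1/6 : ℚ) • bv 20 - (1/3 : ℚ) • bv 21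

/-- The lattice Λ ≅ Λ_K3. -/
def Λ : Submodule ℤ V :=
  Submodule.span ℤ (Set.range bv ∪ {vα, vβ, vγ, vδ, vε, vζ, vη})

theorem B_add_left (u v w : V) : B (u + v) w = B u w + B v w := add_dotProduct _ _ _

theorem B_add_right (u v w : V) : B u (v + w) = B u v + B u w := by
  simp [B, mulVec_add]

theorem B_zsmul_left (n : ℤ) (u v : V) : B (n • u) v = n * B u v := by
  rw [B, smul_dotProduct, zsmul_eq_mul, B]

theorem B_zsmul_right (n : ℤ) (u v : V) : B u (n • v) = n * B u v := by
  rw [B, mulVec_smul, dotProduct_smul, zsmul_eq_mul, B]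

theorem B_comm (u v : V) : B u v = B v u := by
  have hsymm : gramXᵀ = gramX := by
    ext i j
    simp only [transpose_apply, gramX, of_apply, eq_comm (a := j), eq_comm (a := j.val / 2)]
    split_ifs with h <;> simp_all <;> exfalso <;> omega
  rw [B, dotProduct_mulVec, dotProduct_comm, ← mulVec_transpose, hsymm, B]

/-- The index paired with a given one in the block decomposition of `gramX`. -/
def partner : Fin 22 → Fin 22 :=
  ![1, 0, 3, 2, 5, 4, 7, 6, 9, 8, 11, 10, 13, 12, 15, 14, 17, 16, 19, 18, 21, 20]

def gramDiag (i : Fin 22) : ℤ :=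
  if i < 16 then -2 else if i < 18 then -4 else if i < 20 then 0 else 4

def gramOff (i : Fin 22) : ℤ :=
  if i < 16 then 1 else if i < 18 then 2 else if i < 20 then 3 else 2

theorem gramX_apply (i j : Fin 22) :
    gramX i j = (if i = j then (gramDiag i : ℚ) else 0) +
      if partner i = j then (gramOff i : ℚ) else 0 := by
  have hdiv : ∀ i j : Fin 22, i.val / 2 = j.val / 2 ↔ i = j ∨ partner i = j := by decide +kernel
  have hne : ∀ i, partner i ≠ i := by decide +kernel
  by_cases h : i = j
  · subst h
    simp [gramX, gramDiag, hne, Fin.lt_def, apply_ite (Int.cast : ℤ → ℚ)]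
  · simp [gramX, gramOff, hdiv, h, Fin.lt_def, apply_ite (Int.cast : ℤ → ℚ)]

/-- The Gram matrix acting on a vector of integers. -/
def gramAct (v : Fin 22 → ℤ) : Fin 22 → ℤ := fun i =>
  gramDiag i * v i + gramOff i * v (partner i)

/-- The rational vector with coordinates `x i / 6`. -/
def sixth (x : Fin 22 → ℤ) : V := fun i => x i / 6

theorem gramX_mulVec_sixth (x : Fin 22 → ℤ) : gramX *ᵥ sixth x = sixth (gramAct x) := by
  ext i
  simp [gramX_apply, mulVec, dotProduct, sixth, gramAct, add_mul, Finset.sum_add_distrib, add_div,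
    mul_div_assoc]

theorem B_sixth_right (u : V) (x : Fin 22 → ℤ) : B u (sixth x) = u ⬝ᵥ sixth (gramAct x) := by
  rw [B, gramX_mulVec_sixth]

theorem B_sixth (x y : Fin 22 → ℤ) :
    B (sixth x) (sixth y) = ((x ⬝ᵥ gramAct y : ℤ) : ℚ) / 36 := by
  simp only [B_sixth_right, dotProduct, sixth, Int.cast_sum, Int.cast_mul, Finset.sum_div]
  exact Finset.sum_congr rfl fun i _ => by ring

def sixBv (i : Fin 22) : Fin 22 → ℤ := fun j => if i = j then 6 else 0

def sixα : Fin 22 → ℤ := ![-2, 2, 0, 0, 0, 0, 2, -2, -2, 2, 2, -2, -2, 2, 2, -2, 0, 0, 0, 0, 0, 0]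
def sixβ : Fin 22 → ℤ := ![0, 0, -2, 2, 2, -2, 0, 0, -2, 2, 2, -2, 2, -2, -2, 2, 0, 0, 0, 0, 0, 0]
def sixγ : Fin 22 → ℤ := ![0, 0, 0, 0, 0, 0, 0, 0, -2, 2, -2, 2, 0, 0, 0, 0, 0, 0, 2, -2, 0, 0]
def sixδ : Fin 22 → ℤ := ![0, 0, 0, 0, -2, 2, -2, 2, -2, 2, 0, 0, 0, 0, 0, 0, 0, 0, 2, 0, 0, 0]
def sixε : Fin 22 → ℤ := ![0, 0, 0, 0, 2, -2, 0, 0, -2, 2, 0, 0, -2, 2, 2, -2, -2, 2, 2, 0, 0, 0]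
def sixζ : Fin 22 → ℤ := ![0, 0, 0, 0, 4, 2, 0, 0, 2, 4, 0, 0, 2, 4, 4, 2, 2, 1, 4, 0, 0, 3]
def sixη : Fin 22 → ℤ := ![0, 0, 0, 0, 4, 2, 0, 0, 2, 4, 0, 0, 0, 0, 2, -2, -1, 1, 4, 0, 1, -2]

theorem bv_eq_sixth (i : Fin 22) : bv i = sixth (sixBv i) := by
  ext j
  by_cases h : i = j <;> simp [bv, sixth, sixBv, h]

theorem vα_eq_sixth : vα = sixth sixα := by
  ext j
  fin_cases j <;> simp [vα, bv, sixth, sixα] <;> norm_num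

theorem vβ_eq_sixth : vβ = sixth sixβ := by
  ext j
  fin_cases j <;> simp [vβ, bv, sixth, sixβ] <;> norm_num

theorem vγ_eq_sixth : vγ = sixth sixγ := by
  ext j
  fin_cases j <;> simp [vγ, bv, sixth, sixγ] <;> norm_num

theorem vδ_eq_sixth : vδ = sixth sixδ := by
  ext j
  fin_cases j <;> simp [vδ, bv, sixth, sixδ] <;> norm_num

theorem vε_eq_sixth : vε = sixth sixε := by
  ext j
  fin_cases j <;> simp [vε, bv, sixth, sixε] <;> norm_num

theorem vζ_eq_sixth : vζ = sixth sixζ := by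
  ext j
  fin_cases j <;> simp [vζ, bv, sixth, sixζ, vε] <;> norm_num

theorem vη_eq_sixth : vη = sixth sixη := by
  ext j
  fin_cases j <;> simp [vη, bv, sixth, sixη, vε] <;> norm_num

/-- Six times the members of a `ℤ`-basis of `Λ`. -/
def sixBasis : Fin 22 → Fin 22 → ℤ :=
  ![sixα, sixBv 1, sixβ, sixBv 3, sixBv 4, sixBv 5, sixδ, sixBv 7,
    sixBv 8, sixBv 9, sixBv 10, sixBv 11, sixBv 12, sixBv 13, sixBv 14, sixBv 15,
    sixBv 16, sixζ, sixBv 18, sixγ, sixη, sixBv 21]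

/-- The inverse of the Gram matrix of the basis `sixth ∘ sixBasis`. -/
def gramInv : Matrix (Fin 22) (Fin 22) ℤ :=
  !![-6, 3, 0, 0, -2, 2, -6, 0, -4, 4, 2, -2, -2, 2, 2, -2, 0, 0, 2, 0, 0, 0;
     3, -2, 0, 0, 1, -1, 3, 0, 2, -2, -1, 1, 1, -1, -1, 1, 0, 0, -1, 0, 0, 0;
     0, 0, -6, 3, 2, -2, 0, 0, -2, 2, 2, -2, 2, -2, -2, 2, 0, 0, 0, 0, 0, 0;
     0, 0, 3, -2, -1, 1, 0, 0, 1, -1, -1, 1, -1, 1, 1, -1, 0, 0, 0, 0, 0, 0;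
     -2, 1, 2, -1, -8, -1, -4, 1, -4, -4, 0, 0, -4, -4, -4, -4, -2, 8, -4, 0, 0, -4;
     2, -1, -2, 1, -1, -4, 4, -1, 0, -4, 0, 0, 0, -4, -4, 0, -1, 4, -4, 0, 0, -2;
     -6, 3, 0, 0, -4, 4, -12, 3, -6, 6, 2, -2, -2, 2, 2, -2, 0, 0, 4, 0, 0, 0;
     0, 0, 0, 0, 1, -1, 3, -2, 1, -1, 0, 0, 0, 0, 0, 0, 0, 0, -1, 0, 0, 0;
     -4, 2, -2, 1, -4, 0, -6, 1, -6, 1, 2, -2, -2, -2, -2, -2, -1, 4, -1, 0, 0, -2;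
     4, -2, 2, -1, -4, -4, 6, -1, 1, -10, -2, 2, -2, -6, -6, -2, -2, 8, -7, 0, 0, -4;
     2, -1, 2, -1, 0, 0, 2, 0, 2, -2, -2, 1, 0, 0, 0, 0, 0, 0, -1, 0, 0, 0;
     -2, 1, -2, 1, 0, 0, -2, 0, -2, 2, 1, -2, 0, 0, 0, 0, 0, 0, 1, 0, 0, 0;
     -2, 1, 2, -1, -4, 0, -2, 0, -2, -2, 0, 0, -2, 1, 0, 0, 1, 0, -2, 0, 4, 1;
     2, -1, -2, 1, -4, -4, 2, 0, -2, -6, 0, 0, 1, -2, -4, 4, 2, 0, -6, 0, 8, 2;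
     2, -1, -2, 1, -4, -4, 2, 0, -2, -6, 0, 0, 0, -4, -6, 1, 0, 4, -6, 0, 4, -1;
     -2, 1, 2, -1, -4, 0, -2, 0, -2, -2, 0, 0, 0, 4, 1, 2, 3, -4, -2, 0, 8, 4;
     0, 0, 0, 0, -2, -1, 0, 0, -1, -2, 0, 0, 1, 2, 0, 3, 2, -3, -2, 0, 6, 3;
     0, 0, 0, 0, 8, 4, 0, 0, 4, 8, 0, 0, 0, 0, 4, -4, -3, 0, 8, 0, -12, -3;
     2, -1, 0, 0, -4, -4, 4, -1, -1, -7, -1, 1, -2, -6, -6, -2, -2, 8, -6, -1, 0, -4;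
     0, 0, 0, 0, 0, 0, 0, 0, 0, 0, 0, 0, 0, 0, 0, 0, 0, 0, -1, 0, 0, 0;
     0, 0, 0, 0, 0, 0, 0, 0, 0, 0, 0, 0, 4, 8, 4, 8, 6, -12, 0, 0, 12, 9;
     0, 0, 0, 0, -4, -2, 0, 0, -2, -4, 0, 0, 1, 2, -1, 4, 3, -3, -4, 0, 9, 4]

/-- Six times the members of the dual basis. -/
def sixDual (j : Fin 22) : Fin 22 → ℤ := fun k => ∑ i, gramInv j i * sixBasis i k

theorem sixBasis_even (i : Fin 22) : 72 ∣ sixBasis i ⬝ᵥ gramAct (sixBasis i) := by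
  revert i; decide +kernel

theorem sixBasis_integral (i j : Fin 22) : 36 ∣ sixBasis i ⬝ᵥ gramAct (sixBasis j) := by
  revert i j; decide +kernel

theorem sixDual_resolution (k l : Fin 22) :
    ∑ j, gramAct (sixBasis j) l * sixDual j k = if l = k then 36 else 0 := by
  revert k l; decide +kernel

/-- A `ℤ`-basis of `Λ`. -/
def basisΛ (i : Fin 22) : V := sixth (sixBasis i)

theorem sixth_sum_zsmul (c : Fin 22 → ℤ) (x : Fin 22 → Fin 22 → ℤ) :
    sixth (fun k => ∑ i, c i * x i k) = ∑ i, c i • sixth (x i) := by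
  ext k
  simp only [sixth, Int.cast_sum, Int.cast_mul, Finset.sum_div, Finset.sum_apply, Pi.smul_apply,
    mul_div_assoc]
  simp only [zsmul_eq_mul]

theorem sixth_sixDual_mem (j : Fin 22) :
    sixth (sixDual j) ∈ Submodule.span ℤ (Set.range basisΛ) := by
  unfold sixDual
  rw [sixth_sum_zsmul]
  exact Submodule.sum_mem _ fun i _ =>
    Submodule.smul_mem _ _ (Submodule.subset_span (Set.mem_range_self i))

theorem eq_sum_B_smul_dual (y : V) :
    y = ∑ j, B y (basisΛ j) • sixth (sixDual j) := by
  ext k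
  have h (l : Fin 22) : ∑ j, sixth (gramAct (sixBasis j)) l * sixth (sixDual j) k =
      if l = k then 1 else 0 := by
    have h₀ := congrArg (Int.cast : ℤ → ℚ) (sixDual_resolution k l)
    push_cast at h₀
    calc ∑ j, sixth (gramAct (sixBasis j)) l * sixth (sixDual j) k
        = (∑ j, (gramAct (sixBasis j) l : ℚ) * sixDual j k) / 36 := by
          rw [Finset.sum_div]
          exact Finset.sum_congr rfl fun j _ => by simp only [sixth]; ring
      _ = _ := by rw [h₀]; split_ifs <;> norm_num
  simp only [basisΛ, B_sixth_right, dotProduct, Finset.sum_apply, Pi.smul_apply, smul_eq_mul,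
    Finset.sum_mul, mul_assoc]
  rw [Finset.sum_comm]
  simp [← Finset.mul_sum, h]

theorem B_integral_of_mem_span {S T : Set V} (h : ∀ u ∈ S, ∀ v ∈ T, ∃ n : ℤ, B u v = n)
    {u v : V} (hu : u ∈ Submodule.span ℤ S) (hv : v ∈ Submodule.span ℤ T) :
    ∃ n : ℤ, B u v = n := by
  induction hu, hv using Submodule.span_induction₂ with
  | mem_mem u v hu hv => exact h u hu v hv
  | zero_left v _ => exact ⟨0, by simp [B]⟩
  | zero_right u _ => exact ⟨0, by simp [B]⟩
  | add_left u v w _ _ _ h₁ h₂ =>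
    obtain ⟨m, hm⟩ := h₁
    obtain ⟨n, hn⟩ := h₂
    exact ⟨m + n, by rw [B_add_left, hm, hn]; push_cast; rfl⟩
  | add_right u v w _ _ _ h₁ h₂ =>
    obtain ⟨m, hm⟩ := h₁
    obtain ⟨n, hn⟩ := h₂
    exact ⟨m + n, by rw [B_add_right, hm, hn]; push_cast; rfl⟩
  | smul_left r u v _ _ h =>
    obtain ⟨n, hn⟩ := h
    exact ⟨r * n, by rw [B_zsmul_left, hn]; push_cast; rfl⟩
  | smul_right r u v _ _ h =>
    obtain ⟨n, hn⟩ := h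
    exact ⟨r * n, by rw [B_zsmul_right, hn]; push_cast; rfl⟩

theorem B_sixth_integral {x y : Fin 22 → ℤ} (h : 36 ∣ x ⬝ᵥ gramAct y) :
    ∃ n : ℤ, B (sixth x) (sixth y) = n := by
  obtain ⟨n, hn⟩ := h
  exact ⟨n, by rw [B_sixth, hn]; push_cast; ring⟩

theorem mem_span_basisΛ_of_integral {y : V} (h : ∀ j, ∃ n : ℤ, B y (basisΛ j) = n) :
    y ∈ Submodule.span ℤ (Set.range basisΛ) := by
  choose n hn using h
  rw [eq_sum_B_smul_dual y]
  refine Submodule.sum_mem _ fun j _ => ?_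
  rw [hn, Int.cast_smul_eq_zsmul]
  exact Submodule.smul_mem _ _ (sixth_sixDual_mem j)

theorem sixth_mem_span_basisΛ {x : Fin 22 → ℤ} (h : ∀ j, 36 ∣ x ⬝ᵥ gramAct (sixBasis j)) :
    sixth x ∈ Submodule.span ℤ (Set.range basisΛ) :=
  mem_span_basisΛ_of_integral fun j => B_sixth_integral (h j)

theorem Λ_eq_span_basisΛ : Λ = Submodule.span ℤ (Set.range basisΛ) := by
  refine le_antisymm (Submodule.span_le.2 ?_) (Submodule.span_le.2 ?_)
  · rintro _ (⟨i, rfl⟩ | hu)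
    · rw [bv_eq_sixth]
      exact sixth_mem_span_basisΛ (by revert i; decide +kernel)
    · rcases hu with rfl | rfl | rfl | rfl | rfl | rfl | rfl
      · rw [vα_eq_sixth]
        exact sixth_mem_span_basisΛ (by decide +kernel)
      · rw [vβ_eq_sixth]
        exact sixth_mem_span_basisΛ (by decide +kernel)
      · rw [vγ_eq_sixth]
        exact sixth_mem_span_basisΛ (by decide +kernel)
      · rw [vδ_eq_sixth]
        exact sixth_mem_span_basisΛ (by decide +kernel)
      · rw [vε_eq_sixth]
        exact sixth_mem_span_basisΛ (by decide +kernel)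
      · rw [vζ_eq_sixth]
        exact sixth_mem_span_basisΛ (by decide +kernel)
      · rw [vη_eq_sixth]
        exact sixth_mem_span_basisΛ (by decide +kernel)
  · rintro _ ⟨i, rfl⟩
    have hbv (k : Fin 22) : sixth (sixBv k) ∈ Λ :=
      bv_eq_sixth k ▸ Submodule.subset_span (Or.inl ⟨k, rfl⟩)
    have hspecial {v : V} (hv : v ∈ ({vα, vβ, vγ, vδ, vε, vζ, vη} : Set V)) : v ∈ Λ :=
      Submodule.subset_span (Or.inr hv)
    have hα : sixth sixα ∈ Λ := vα_eq_sixth ▸ hspecial (by simp)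
    have hβ : sixth sixβ ∈ Λ := vβ_eq_sixth ▸ hspecial (by simp)
    have hγ : sixth sixγ ∈ Λ := vγ_eq_sixth ▸ hspecial (by simp)
    have hδ : sixth sixδ ∈ Λ := vδ_eq_sixth ▸ hspecial (by simp)
    have hζ : sixth sixζ ∈ Λ := vζ_eq_sixth ▸ hspecial (by simp)
    have hη : sixth sixη ∈ Λ := vη_eq_sixth ▸ hspecial (by simp)
    fin_cases i
    exacts [hα, hbv 1, hβ, hbv 3, hbv 4, hbv 5, hδ, hbv 7, hbv 8, hbv 9, hbv 10, hbv 11, hbv 12,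
      hbv 13, hbv 14, hbv 15, hbv 16, hζ, hbv 18, hγ, hη, hbv 21]

theorem Λ_integral {u v : V} (hu : u ∈ Λ) (hv : v ∈ Λ) : ∃ n : ℤ, B u v = n := by
  rw [Λ_eq_span_basisΛ] at hu hv
  refine B_integral_of_mem_span ?_ hu hv
  rintro _ ⟨i, rfl⟩ _ ⟨j, rfl⟩
  exact B_sixth_integral (sixBasis_integral i j)

theorem Λ_even {u : V} (hu : u ∈ Λ) : ∃ n : ℤ, B u u = 2 * (n : ℚ) := by
  rw [Λ_eq_span_basisΛ] at hu
  induction hu using Submodule.span_induction with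
  | mem u hu =>
    obtain ⟨i, rfl⟩ := hu
    obtain ⟨n, hn⟩ := sixBasis_even i
    exact ⟨n, by rw [basisΛ, B_sixth, hn]; push_cast; ring⟩
  | zero => exact ⟨0, by simp [B]⟩
  | add u v hu hv hu' hv' =>
    rw [← Λ_eq_span_basisΛ] at hu hv
    obtain ⟨k, hk⟩ := Λ_integral hu hv
    obtain ⟨m, hm⟩ := hu'
    obtain ⟨n, hn⟩ := hv'
    refine ⟨m + k + n, ?_⟩
    rw [B_add_left, B_add_right, B_add_right, B_comm v u, hk, hm, hn]
    push_cast
    ring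
  | smul r u _ hu' =>
    obtain ⟨n, hn⟩ := hu'
    refine ⟨r * r * n, ?_⟩
    rw [B_zsmul_left, B_zsmul_right, hn]
    push_cast
    ring

theorem mem_Λ_of_mem_W {w : V} (hw : w ∈ W) : w ∈ Λ := by
  choose n hn using hw
  have h : w = ∑ i, n i • bv i := by
    ext k
    simp [bv, hn, Finset.sum_apply]
  rw [h]
  exact Submodule.sum_mem _ fun i _ =>
    Submodule.smul_mem _ _ (Submodule.subset_span (Or.inl ⟨i, rfl⟩))

theorem six_smul_mem_W {u : V} (hu : u ∈ Λ) : ((6 : ℕ) : ℚ) • u ∈ W := by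
  rw [Λ_eq_span_basisΛ] at hu
  induction hu using Submodule.span_induction with
  | mem u hu =>
    obtain ⟨i, rfl⟩ := hu
    exact fun k => ⟨sixBasis i k, by simp [basisΛ, sixth]; ring⟩
  | zero => exact fun k => ⟨0, by simp⟩
  | add u v _ _ hu hv =>
    intro k
    obtain ⟨m, hm⟩ := hu k
    obtain ⟨n, hn⟩ := hv k
    exact ⟨m + n, by rw [smul_add, Pi.add_apply, hm, hn]; push_cast; rfl⟩
  | smul r u _ hu =>
    intro k
    obtain ⟨n, hn⟩ := hu k
    exact ⟨r * n, by rw [smul_comm, Pi.smul_apply, hn, zsmul_eq_mul]; push_cast; rfl⟩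

theorem mem_Λ_iff (y : V) : y ∈ Λ ↔ ∀ u ∈ Λ, ∃ n : ℤ, B y u = n := by
  refine ⟨fun hy u hu => Λ_integral hy hu, fun h => ?_⟩
  rw [Λ_eq_span_basisΛ] at h ⊢
  exact mem_span_basisΛ_of_integral fun j => h _ (Submodule.subset_span ⟨j, rfl⟩)

/-- An additive involution sending the basis of `Λ` into `Λ` preserves `Λ`. -/
theorem image_Λ_eq {f : V → V} (F : V →ₗ[ℤ] V) (hF : ∀ u, F u = f u)
    (hf : Function.Involutive f) (h : ∀ i, f (basisΛ i) ∈ Submodule.span ℤ (Set.range basisΛ)) :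
    f '' (Λ : Set V) = (Λ : Set V) := by
  have hle : ∀ u ∈ Λ, f u ∈ Λ := by
    have : Λ ≤ Λ.comap F := by
      rw [Λ_eq_span_basisΛ, Submodule.span_le]
      rintro _ ⟨i, rfl⟩
      simpa [hF] using h i
    exact fun u hu => hF u ▸ this hu
  refine Set.Subset.antisymm ?_ fun u hu => ⟨f u, hle u hu, hf u⟩
  rintro _ ⟨u, hu, rfl⟩
  exact hle u hu

def tauLinear : V →ₗ[ℤ] V where
  toFun := tau
  map_add' u v := by ext i; simp [tau, mul_add]
  map_smul' r u := by ext i; simp [tau, mul_left_comm]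

def phiLinear : V →ₗ[ℤ] V where
  toFun := phi
  map_add' _ _ := rfl
  map_smul' _ _ := rfl

theorem tau_involutive : Function.Involutive tau := by
  intro u
  ext i
  fin_cases i <;> simp [tau, tauSign, tauIdx]

theorem phi_involutive : Function.Involutive phi := by
  intro u
  ext i
  fin_cases i <;> rfl

theorem phi_sixth (x : Fin 22 → ℤ) : phi (sixth x) = sixth (x ∘ phiIdx) := rfl

def tauSignInt : Fin 22 → ℤ :=
  ![1,1,1,1,1,1,1,1,1,1,1,1,1,1,1,1,-1,-1,1,1,1,1]

theorem tau_sixth (x : Fin 22 → ℤ) :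
    tau (sixth x) = sixth fun i => tauSignInt i * x (tauIdx i) := by
  have hsign (i : Fin 22) : tauSign i = tauSignInt i := by
    fin_cases i <;> simp [tauSign, tauSignInt]
  ext i
  simp [tau, sixth, hsign, mul_div_assoc]

theorem tau_basisΛ_mem (i : Fin 22) :
    tau (basisΛ i) ∈ Submodule.span ℤ (Set.range basisΛ) := by
  rw [basisΛ, tau_sixth]
  exact sixth_mem_span_basisΛ (by revert i; decide +kernel)

theorem phi_basisΛ_mem (i : Fin 22) :
    phi (basisΛ i) ∈ Submodule.span ℤ (Set.range basisΛ) := by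
  rw [basisΛ, phi_sixth]
  exact sixth_mem_span_basisΛ (by revert i; decide +kernel)

/-- Λ is an even lattice containing W with finite index, Λ equals
its own dual lattice (so Λ is unimodular), and τ(Λ) = Λ, φ(Λ) = Λ. -/
theorem stmt1 :
    (∀ u ∈ Λ, ∀ v ∈ Λ, ∃ n : ℤ, B u v = (n : ℚ)) ∧
    (∀ u ∈ Λ, ∃ n : ℤ, B u u = 2 * (n : ℚ)) ∧
    (∀ w ∈ W, w ∈ Λ) ∧
    (∃ k : ℕ, 0 < k ∧ ∀ u ∈ Λ, (k : ℚ) • u ∈ W) ∧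
    (∀ y : V, y ∈ Λ ↔ ∀ u ∈ Λ, ∃ n : ℤ, B y u = (n : ℚ)) ∧
    tau '' (Λ : Set V) = (Λ : Set V) ∧ phi '' (Λ : Set V) = (Λ : Set V) := by
  exact ⟨fun _ hu _ hv => Λ_integral hu hv, fun _ hu => Λ_even hu, fun _ hw => mem_Λ_of_mem_W hw,
    ⟨6, by norm_num, fun _ hu => six_smul_mem_W hu⟩, mem_Λ_iff,
    image_Λ_eq tauLinear (fun _ => rfl) tau_involutive tau_basisΛ_mem,
    image_Λ_eq phiLinear (fun _ => rfl) phi_involutive phi_basisΛ_mem⟩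
end
end

section
/- The invariant lattice of the action, namely {u ∈ Λ : τ(u) = u and φ(u) = u}, equals the ℤ-submodule of V generated by the thirteen vectors a_1+b_1+c_1+d_1, a_2+b_2+c_2+d_2, e_1+f_1, e_2+f_2, g_1+h_1, g_2+h_2, x, y, v_1, v_2, (v_1+v_2+g_1+h_1-g_2-h_2)/3, (a_1+b_1+c_1+d_1-(a_2+b_2+c_2+d_2)+e_1+f_1-e_2-f_2+x)/3, and γ = (x-y-e_1+e_2-f_1+f_2)/3. -/
/- Context: V = ℚ^22 with the Gram matrix of the paper, W = ℤ^22,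
τ and φ the involutions of the symplectic (ℤ/2ℤ)²-action,
and Λ ≃ Λ_K3 the overlattice of W generated by the standard basis together
with the seven vectors α,β,γ,δ,ε,ζ,η. -/

noncomputable section
open Matrix

/-- The thirteen generators of the invariant lattice. -/
def invGens : Set V :=
  {bv 0 + bv 2 + bv 4 + bv 6,
   bv 1 + bv 3 + bv 5 + bv 7,
   bv 8 + bv 10,
   bv 9 + bv 11,
   bv 12 + bv 14,
   bv 13 + bv 15,
   bv 18, bv 19, bv 20, bv 21,
   (1/3 : ℚ) • (bv 20 + bv 21 + bv 12 + bv 14 - bv 13 - bv 15),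
   (1/3 : ℚ) • (bv 0 + bv 2 + bv 4 + bv 6 - (bv 1 + bv 3 + bv 5 + bv 7)
      + bv 8 + bv 10 - bv 9 - bv 11 + bv 18),
   vγ}

/-- The ten of the generators `invGens` that form a basis of the invariant lattice. -/
def invBasis : Fin 10 → V :=
  ![bv 1 + bv 3 + bv 5 + bv 7, bv 8 + bv 10, bv 9 + bv 11, bv 12 + bv 14, bv 13 + bv 15,
    bv 18, bv 20, (1/3 : ℚ) • (bv 20 + bv 21 + bv 12 + bv 14 - bv 13 - bv 15),
    (1/3 : ℚ) • (bv 0 + bv 2 + bv 4 + bv 6 - (bv 1 + bv 3 + bv 5 + bv 7)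
      + bv 8 + bv 10 - bv 9 - bv 11 + bv 18),
    vγ]

/-- Ten functionals that are integral on `Λ` and restrict to the coordinates with respect to
`invBasis` on the invariant subspace. -/
def invCoord : Matrix (Fin 10) (Fin 22) ℚ :=
  !![0, 0, 0, 0, 0, 0, 1, 1, 0, 0, 0, 0, 0, 0, 0, 0, 0, 0, 0, 0, 0, 0;
     0, 0, 0, 0, 0, -1, -1, 1, 1, 0, 0, 0, 0, 0, 0, 0, 0, 0, 0, -1, 0, 0;
     0, 0, 0, 0, 0, 1, 1, -1, 0, 1, 0, 0, 0, 0, 0, 0, 0, 0, 0, 1, 0, 0;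
     1, 0, -1, 0, 1, 0, -1, 0, 0, 0, 0, 0, 1, 0, 0, 0, 1, 1, 0, 0, 0, -1;
     0, 0, 0, 0, 0, 0, 0, 0, 0, 0, 0, 0, -1, 1, 1, 0, -1, -1, 0, 0, 0, 1;
     -1, 0, -1, 0, 0, 1, 1, -1, 0, 0, 0, 0, 0, 0, 0, 0, 0, 0, 1, 1, 0, 0;
     1, 0, -1, 0, -1, 0, 1, 0, 0, 0, 0, 0, 0, 0, 0, 0, 0, 1, 0, 0, 1, -1;
     0, 0, 0, 0, -1, 0, 1, 0, 0, 0, 0, 0, -1, 0, 1, 0, -3, -1, 0, 0, 0, 3;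
     0, 0, 0, 0, 1, 1, 2, -1, 0, 0, 0, 0, 0, 0, 0, 0, 0, 0, 0, 0, 0, 0;
     0, 0, 0, 0, 0, 0, 0, 0, 0, 0, 0, 0, 0, 0, 0, 0, 0, 0, 0, -3, 0, 0]

theorem invBasis_mem_invGens (j : Fin 10) : invBasis j ∈ invGens := by
  revert j
  simp only [Fin.forall_fin_succ, invBasis, cons_val_zero, cons_val_succ, invGens,
    Set.mem_insert_iff, Set.mem_singleton_iff, true_or, or_true, and_true, IsEmpty.forall_iff]

theorem exists_int_of_den_eq_one {q : ℚ} (h : q.den = 1) : ∃ n : ℤ, q = n :=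
  ⟨q.num, (Rat.den_eq_one_iff q |>.mp h).symm⟩

theorem den_invCoord (j : Fin 10) (i : Fin 22) : (invCoord j i).den = 1 := by
  revert j i
  decide +kernel

theorem invCoord_mulVec_bv (i : Fin 22) : invCoord *ᵥ bv i = invCoord.col i := by
  ext j
  simp [mulVec, dotProduct, bv]

/-- The generators of `Λ` outside the standard lattice. -/
def glue : Fin 7 → V := ![vα, vβ, vγ, vδ, vε, vζ, vη]

theorem den_invCoord_mulVec_glue (k : Fin 7) (j : Fin 10) :
    ((invCoord *ᵥ glue k) j).den = 1 := by
  revert j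
  fin_cases k <;>
    simp only [glue, cons_val, Fin.zero_eta, Fin.mk_one, Fin.reduceFinMk, vα, vβ, vγ, vδ, vε, vζ,
      vη, mulVec_add, mulVec_sub, mulVec_neg, mulVec_smul, invCoord_mulVec_bv] <;>
    decide +kernel

theorem Λ_eq_span : Λ = Submodule.span ℤ (Set.range bv ∪ Set.range glue) := by
  simp only [Λ, glue, range_cons, range_empty, Set.union_empty, Set.singleton_union]

theorem invCoord_mulVec_integral {u : V} (hu : u ∈ Λ) (j : Fin 10) :
    ∃ n : ℤ, (invCoord *ᵥ u) j = n := by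
  rw [Λ_eq_span] at hu
  induction hu using Submodule.span_induction with
  | mem v hv =>
    apply exists_int_of_den_eq_one
    rcases hv with ⟨i, rfl⟩ | ⟨k, rfl⟩
    · rw [invCoord_mulVec_bv]
      exact den_invCoord j i
    · exact den_invCoord_mulVec_glue k j
  | zero => exact ⟨0, by simp⟩
  | add v w _ _ hv hw =>
    obtain ⟨m, hm⟩ := hv
    obtain ⟨n, hn⟩ := hw
    exact ⟨m + n, by simp [mulVec_add, hm, hn]⟩
  | smul c v _ hv =>
    obtain ⟨m, hm⟩ := hv
    exact ⟨c * m, by rw [mulVec_smul, Pi.smul_apply, hm]; simp⟩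

theorem eq_sum_invCoord_smul_invBasis {u : V} (ht : tau u = u) (hp : phi u = u) :
    u = ∑ j, (invCoord *ᵥ u) j • invBasis j := by
  have t (i : Fin 22) : tauSign i * u (tauIdx i) = u i := congrFun ht i
  have p (i : Fin 22) : u (phiIdx i) = u i := congrFun hp i
  have t0 : u 2 = u 0 := by simpa [tauSign, tauIdx] using t 0
  have t1 : u 3 = u 1 := by simpa [tauSign, tauIdx] using t 1
  have p0 : u 6 = u 0 := by simpa [phiIdx] using p 0
  have p1 : u 7 = u 1 := by simpa [phiIdx] using p 1
  have p2 : u 4 = u 2 := by simpa [phiIdx] using p 2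
  have p3 : u 5 = u 3 := by simpa [phiIdx] using p 3
  have p8 : u 10 = u 8 := by simpa [phiIdx] using p 8
  have p9 : u 11 = u 9 := by simpa [phiIdx] using p 9
  have p12 : u 14 = u 12 := by simpa [phiIdx] using p 12
  have p13 : u 15 = u 13 := by simpa [phiIdx] using p 13
  have t16 : -u 16 = u 16 := by simpa [tauSign, tauIdx] using t 16
  have t17 : -u 17 = u 17 := by simpa [tauSign, tauIdx] using t 17
  have z16 : u 16 = 0 := by linarith
  have z17 : u 17 = 0 := by linarith
  have hc : invCoord *ᵥ u =
      ![u 0 + u 1, u 8 - u 0 - u 19, u 9 + u 0 + u 19, u 12 - u 21, u 13 + u 21,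
        u 18 + u 19 - u 0, u 20 - u 21, 3 * u 21, 3 * u 0, -3 * u 19] := by
    ext j
    fin_cases j <;>
      simp [mulVec, invCoord, vecHead, vecTail, p0, p1, p2, p3, p8, p9, p12, p13, t0, t1,
        z16, z17] <;>
      ring
  rw [hc]
  ext i
  simp only [Fin.sum_univ_succ, Finset.sum_apply, Pi.smul_apply]
  fin_cases i <;> simp [invBasis, vγ, bv] <;> linarith

theorem bv_mem_Λ (i : Fin 22) : bv i ∈ Λ :=
  Submodule.subset_span (Or.inl ⟨i, rfl⟩)

theorem invGens_subset_Λ : invGens ⊆ Λ := by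
  have hα : vα ∈ Λ := Submodule.subset_span (by simp)
  have hβ : vβ ∈ Λ := Submodule.subset_span (by simp)
  have hγ : vγ ∈ Λ := Submodule.subset_span (by simp)
  have hδ : vδ ∈ Λ := Submodule.subset_span (by simp)
  have hε : vε ∈ Λ := Submodule.subset_span (by simp)
  have hη : vη ∈ Λ := Submodule.subset_span (by simp)
  have b := bv_mem_Λ
  intro v hv
  simp only [invGens, Set.mem_insert_iff, Set.mem_singleton_iff] at hv
  rcases hv with rfl | rfl | rfl | rfl | rfl | rfl | rfl | rfl | rfl | rfl | rfl | rfl | rfl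
  · exact add_mem (add_mem (add_mem (b 0) (b 2)) (b 4)) (b 6)
  · exact add_mem (add_mem (add_mem (b 1) (b 3)) (b 5)) (b 7)
  · exact add_mem (b 8) (b 10)
  · exact add_mem (b 9) (b 11)
  · exact add_mem (b 12) (b 14)
  · exact add_mem (b 13) (b 15)
  · exact b 18
  · exact b 19
  · exact b 20
  · exact b 21
  · have key : (1/3 : ℚ) • (bv 20 + bv 21 + bv 12 + bv 14 - bv 13 - bv 15) =
        (2 : ℤ) • (vε + bv 18 + bv 4 + bv 5 + bv 8 + bv 9) - (4 : ℤ) • vη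
          + (bv 12 - bv 13 + bv 14 - bv 15 + bv 20 - bv 21) := by
      simp only [vη, vε]
      module
    rw [key]
    exact add_mem (sub_mem (zsmul_mem (add_mem (add_mem (add_mem (add_mem (add_mem hε (b 18))
      (b 4)) (b 5)) (b 8)) (b 9)) _) (zsmul_mem hη _))
      (sub_mem (add_mem (sub_mem (add_mem (sub_mem (b 12) (b 13)) (b 14)) (b 15)) (b 20)) (b 21))
  · have key : (1/3 : ℚ) • (bv 0 + bv 2 + bv 4 + bv 6 - (bv 1 + bv 3 + bv 5 + bv 7)
          + bv 8 + bv 10 - bv 9 - bv 11 + bv 18) =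
        (2 : ℤ) • (bv 10 - bv 11 - vδ) + bv 19 - vα - vβ + (3 : ℤ) • vγ := by
      simp only [vα, vβ, vγ, vδ]
      module
    rw [key]
    exact add_mem (sub_mem (sub_mem (add_mem (zsmul_mem (sub_mem (sub_mem (b 10) (b 11)) hδ) _)
      (b 19)) hα) hβ) (zsmul_mem hγ _)
  · exact hγ

theorem tau_phi_eq_self_of_mem_span_invGens {u : V} (hu : u ∈ Submodule.span ℤ invGens) :
    tau u = u ∧ phi u = u := by
  induction hu using Submodule.span_induction with
  | mem v hv =>
    simp only [invGens, Set.mem_insert_iff, Set.mem_singleton_iff] at hv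
    rcases hv with rfl | rfl | rfl | rfl | rfl | rfl | rfl | rfl | rfl | rfl | rfl | rfl | rfl <;>
      decide +kernel
  | zero => exact ⟨by ext; simp [tau], rfl⟩
  | add v w _ _ hv hw =>
    have ht : tau (v + w) = tau v + tau w := by ext; simp [tau, mul_add]
    have hp : phi (v + w) = phi v + phi w := rfl
    exact ⟨by rw [ht, hv.1, hw.1], by rw [hp, hv.2, hw.2]⟩
  | smul c v _ hv =>
    have ht : tau (c • v) = c • tau v := by ext; simp [tau, mul_left_comm]
    have hp : phi (c • v) = c • phi v := rfl
    exact ⟨by rw [ht, hv.1], by rw [hp, hv.2]⟩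

/-- the invariant lattice {u ∈ Λ : τu = u, φu = u} equals the
ℤ-submodule generated by the thirteen listed vectors. -/
theorem stmt2 :
    {u : V | u ∈ Λ ∧ tau u = u ∧ phi u = u} =
      (Submodule.span ℤ invGens : Set V) := by
  ext u
  constructor
  · rintro ⟨hu, ht, hp⟩
    rw [SetLike.mem_coe, eq_sum_invCoord_smul_invBasis ht hp]
    refine Submodule.sum_mem _ fun j _ => ?_
    obtain ⟨n, hn⟩ := invCoord_mulVec_integral hu j
    rw [hn, Int.cast_smul_eq_zsmul]
    exact zsmul_mem (Submodule.subset_span (invBasis_mem_invGens j)) n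
  · intro hu
    exact ⟨Submodule.span_le.mpr invGens_subset_Λ hu, tau_phi_eq_self_of_mem_span_invGens hu⟩
end
end

section
/- Let Ω^∨ = {y in the ℚ-span of Ω : ⟨y,u⟩ ∈ ℤ for all u ∈ Ω} be the dual lattice of Ω. Then the discriminant group Ω^∨/Ω is isomorphic, as an abelian group, to (ℤ/2ℤ)^6 × (ℤ/4ℤ)^2. -/
/- Context: V = ℚ^22 with the Gram matrix of the paper, and Ω = Ω_{2,2} ⊂ V
the co-invariant lattice, generated by the fifteen listed vectors. -/

noncomputable section
open Matrix

def ΩGens : Set V :=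
  {bv 16, bv 17,
   bv 10 - bv 8, bv 11 - bv 9, bv 14 - bv 12, bv 15 - bv 13,
   bv 2 - bv 0, bv 0 - bv 4, bv 4 - bv 6, bv 1 - bv 3, bv 5 - bv 1, bv 7 - bv 5,
   (1/3 : ℚ) • (bv 0 - bv 2 - bv 4 + bv 6 - bv 1 + bv 3 + bv 5 - bv 7 + bv 16 - bv 17),
   (1/3 : ℚ) • (-(bv 0) + bv 6 + bv 1 - bv 7 - bv 8 + bv 10 + bv 9 - bv 11
      - bv 12 + bv 14 + bv 13 - bv 15),
   (1/3 : ℚ) • (bv 0 + bv 2 - bv 4 - bv 6 - bv 1 - bv 3 + bv 5 + bv 7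
      - bv 8 + bv 10 + bv 9 - bv 11)}

/-- The co-invariant lattice Ω = Ω_{2,2}. -/
def Ω : Submodule ℤ V := Submodule.span ℤ ΩGens

/-- The dual lattice Ω^∨ = {y ∈ ℚ-span of Ω : ⟨y,u⟩ ∈ ℤ for all u ∈ Ω}. -/
def ΩDual : Submodule ℤ V where
  carrier := {y | y ∈ Submodule.span ℚ (Ω : Set V) ∧ ∀ u ∈ Ω, ∃ n : ℤ, B y u = (n : ℚ)}
  zero_mem' := ⟨Submodule.zero_mem _, fun u _ => ⟨0, by simp [B]⟩⟩
  add_mem' := by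
    rintro a b ⟨ha1, ha2⟩ ⟨hb1, hb2⟩
    refine ⟨Submodule.add_mem _ ha1 hb1, fun u hu => ?_⟩
    obtain ⟨n, hn⟩ := ha2 u hu
    obtain ⟨m, hm⟩ := hb2 u hu
    refine ⟨n + m, ?_⟩
    have h : B (a + b) u = B a u + B b u := by simp [B, add_dotProduct]
    rw [h, hn, hm]; push_cast; ring
  smul_mem' := by
    rintro c a ⟨ha1, ha2⟩
    have hcast : c • a = (c : ℚ) • a := (Int.cast_smul_eq_zsmul ℚ c a).symm
    constructor
    · rw [hcast]; exact Submodule.smul_mem _ _ ha1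
    · intro u hu
      obtain ⟨n, hn⟩ := ha2 u hu
      refine ⟨c * n, ?_⟩
      have h : B (c • a) u = (c : ℚ) * B a u := by
        rw [hcast]; simp [B, smul_dotProduct]
      rw [h, hn]; push_cast; ring

/-- The fifteen generators of `Ω`, indexed by `Fin 15`. -/
def gen : Fin 15 → V :=
  ![bv 16, bv 17,
    bv 10 - bv 8, bv 11 - bv 9, bv 14 - bv 12, bv 15 - bv 13,
    bv 2 - bv 0, bv 0 - bv 4, bv 4 - bv 6, bv 1 - bv 3, bv 5 - bv 1, bv 7 - bv 5,
    (1/3 : ℚ) • (bv 0 - bv 2 - bv 4 + bv 6 - bv 1 + bv 3 + bv 5 - bv 7 + bv 16 - bv 17),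
    (1/3 : ℚ) • (-(bv 0) + bv 6 + bv 1 - bv 7 - bv 8 + bv 10 + bv 9 - bv 11
      - bv 12 + bv 14 + bv 13 - bv 15),
    (1/3 : ℚ) • (bv 0 + bv 2 - bv 4 - bv 6 - bv 1 - bv 3 + bv 5 + bv 7
      - bv 8 + bv 10 + bv 9 - bv 11)]

/-- The elementary divisors of the Gram matrix of `Ω`. -/
def elemDiv : Fin 12 → ℕ := ![2, 2, 2, 2, 2, 2, 4, 4, 1, 1, 1, 1]

/-- Coefficients, in terms of `gen`, of a basis of `Ω` adapted to the inclusion `Ω ⊆ Ω^∨`. -/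
def leftCoeff : Fin 12 → Fin 15 → ℤ :=
  ![![0, -1, 0, 0, 0, 0, 0, 0, 0, 0, 0, 0, 0, 0, 0],
    ![0, 0, 0, 0, 1, 0, 0, -2, 0, 0, 0, 0, 2, -2, 2],
    ![0, -1, 0, 0, 0, 1, 0, 0, 0, 0, 0, 0, 1, 0, 0],
    ![0, 0, 1, 0, 0, 0, 1, 2, -1, 0, 0, 0, -1, 0, -2],
    ![0, 2, -1, -1, 0, 0, 0, 0, 0, 0, 0, 0, 1, 0, 1],
    ![0, 0, -1, -1, 0, 0, 0, 0, 0, 0, 0, 0, 0, 0, 0],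
    ![0, 2, 1, -1, 0, -2, 1, 0, -1, 0, -2, 0, 0, -2, -1],
    ![0, -2, 0, 2, 0, 0, -1, -2, 1, 0, 0, 0, 0, 0, 2],
    ![0, 0, 0, 0, 0, 0, 0, 0, -1, 0, -1, 0, 0, 0, 0],
    ![0, 1, 1, -2, 1, -1, 1, 0, 0, 0, 0, 0, 1, -3, -1],
    ![0, -1, 0, 0, 0, 0, 0, 0, 1, 0, 0, 0, 0, 0, 0],
    ![0, 2, -1, 0, 0, 0, 0, -1, 0, 0, -1, 0, 2, 0, 2]]

/-- Coefficients, in terms of `gen`, of a basis of `Ω` biorthogonal to that of `leftCoeff`. -/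
def rightCoeff : Fin 12 → Fin 15 → ℤ :=
  ![![0, 0, 0, 0, 1, 2, 0, 0, 0, 0, 0, 0, -1, 0, 0],
    ![0, 0, 0, 0, 0, -1, -1, 2, 1, 0, 0, 0, 0, 0, -2],
    ![0, 0, 0, 0, 1, 0, 0, 0, 0, 0, 0, 0, 0, 0, 0],
    ![0, 0, 0, 0, 0, 0, -1, -2, -1, 0, 0, 0, 0, 0, 1],
    ![0, 1, 0, 0, 1, 0, 1, 0, 1, 0, 0, 0, 2, 0, -1],
    ![0, 0, 1, 0, 0, 0, 0, 0, 0, 0, 0, 0, 0, 0, 0],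
    ![0, 0, 0, 0, 2, 0, -1, 2, 1, 0, 0, 0, 0, 0, -2],
    ![0, 0, 1, -1, 0, 2, 3, 0, 1, 0, 2, 0, 0, 2, -1],
    ![0, 0, 0, 0, -1, 0, 1, 1, 1, 0, 1, 0, 0, 1, -1],
    ![0, 0, -1, 1, -1, 1, 0, -1, 0, 0, 0, 0, 0, 2, 2],
    ![0, 0, 0, 0, 0, -1, -1, -1, -1, 0, 0, 0, 0, -1, 0],
    ![0, -1, 1, -1, 0, 0, 0, 0, -1, 0, 1, 0, -2, -1, -1]]

/-- A basis of `Ω` such that `leftBasis i / elemDiv i` is a basis of `Ω^∨`. -/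
def leftBasis (i : Fin 12) : V := ∑ k, leftCoeff i k • gen k

/-- The basis of `Ω` dual to the vectors `leftBasis i / elemDiv i`. -/
def rightBasis (i : Fin 12) : V := ∑ k, rightCoeff i k • gen k

theorem ΩGens_eq : ΩGens = Set.range gen := by
  simp only [gen, Matrix.range_cons, Matrix.range_empty, Set.union_empty, Set.singleton_union]
  rfl

theorem B_left_right (i j : Fin 12) :
    B (leftBasis i) (rightBasis j) = if i = j then (elemDiv i : ℚ) else 0 := by
  revert i j; decide +kernel

theorem gen_eq_sum (k : Fin 15) :
    gen k = ∑ i, (B (gen k) (rightBasis i) / elemDiv i) • leftBasis i := by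
  revert k; decide +kernel

theorem den_B_gen_right (k : Fin 15) (i : Fin 12) :
    (B (gen k) (rightBasis i) / elemDiv i).den = 1 := by
  revert k i; decide +kernel

theorem den_B_left_gen (i : Fin 12) (k : Fin 15) :
    (B (leftBasis i) (gen k) / elemDiv i).den = 1 := by
  revert i k; decide +kernel

theorem elemDiv_ne_zero (i : Fin 12) : (elemDiv i : ℚ) ≠ 0 := by
  revert i; decide +kernel

theorem B_eq_toBilin' (u v : V) : B u v = Matrix.toBilin' gramX u v :=
  (Matrix.toBilin'_apply' gramX u v).symm

theorem Ω_eq_span_range : Ω = Submodule.span ℤ (Set.range gen) := by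
  rw [Ω, ΩGens_eq]

theorem gen_mem (k : Fin 15) : gen k ∈ Ω := by
  rw [Ω_eq_span_range]
  exact Submodule.subset_span ⟨k, rfl⟩

theorem leftBasis_mem (i : Fin 12) : leftBasis i ∈ Ω :=
  Submodule.sum_mem _ fun k _ => Submodule.smul_mem _ _ (gen_mem k)

theorem rightBasis_mem (i : Fin 12) : rightBasis i ∈ Ω :=
  Submodule.sum_mem _ fun k _ => Submodule.smul_mem _ _ (gen_mem k)

theorem eq_sum_leftBasis {y : V} (hy : y ∈ Submodule.span ℚ (Ω : Set V)) :
    y = ∑ i, (B y (rightBasis i) / elemDiv i) • leftBasis i := by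
  rw [Ω_eq_span_range, Submodule.span_span_of_tower] at hy
  induction hy using Submodule.span_induction with
  | mem x hx => obtain ⟨k, rfl⟩ := hx; exact gen_eq_sum k
  | zero => simp [B_eq_toBilin']
  | add x y _ _ hx hy =>
    conv_lhs => rw [hx, hy]
    simp [B_eq_toBilin', add_div, add_smul, Finset.sum_add_distrib]
  | smul c x _ hx =>
    conv_lhs => rw [hx]
    simp [B_eq_toBilin', mul_div_assoc, mul_smul, Finset.smul_sum]

/-- An additive map to `ℚ` that is integral on the generators is integral on `Ω`. -/
theorem exists_intCast_eq (f : V →+ ℚ) (hf : ∀ k, (f (gen k)).den = 1) {u : V} (hu : u ∈ Ω) :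
    ∃ n : ℤ, f u = n := by
  rw [Ω_eq_span_range] at hu
  induction hu using Submodule.span_induction with
  | mem x hx =>
    obtain ⟨k, rfl⟩ := hx
    exact ⟨(f (gen k)).num, (Rat.coe_int_num_of_den_eq_one (hf k)).symm⟩
  | zero => exact ⟨0, by simp⟩
  | add x y _ _ hx hy =>
    obtain ⟨m, hm⟩ := hx
    obtain ⟨n, hn⟩ := hy
    exact ⟨m + n, by rw [map_add, hm, hn, Int.cast_add]⟩
  | smul c x _ hx =>
    obtain ⟨m, hm⟩ := hx
    exact ⟨c * m, by rw [map_zsmul, hm, zsmul_eq_mul, Int.cast_mul]⟩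

theorem exists_B_rightBasis_div_eq {y : V} (hy : y ∈ Ω) (i : Fin 12) :
    ∃ n : ℤ, B y (rightBasis i) / elemDiv i = n :=
  exists_intCast_eq
    (AddMonoidHom.mk' (fun y => B y (rightBasis i) / elemDiv i) fun x y => by
      simp [B_eq_toBilin', add_div])
    (fun k => den_B_gen_right k i) hy

theorem exists_B_smul_leftBasis_eq (i : Fin 12) {u : V} (hu : u ∈ Ω) :
    ∃ n : ℤ, B ((elemDiv i : ℚ)⁻¹ • leftBasis i) u = n := by
  refine exists_intCast_eq
    (AddMonoidHom.mk' (fun u => B ((elemDiv i : ℚ)⁻¹ • leftBasis i) u) fun x y => by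
      simp [B_eq_toBilin', mul_add])
    (fun k => ?_) hu
  rw [← den_B_left_gen i k]
  simp [B_eq_toBilin', div_eq_inv_mul]

/-- The vectors of `Ω^∨` whose pairings with `rightBasis` are those of the standard basis. -/
def dualVec (i : Fin 12) : ΩDual :=
  ⟨(elemDiv i : ℚ)⁻¹ • leftBasis i,
    Submodule.smul_mem _ _ (Submodule.subset_span (leftBasis_mem i)),
    fun _ hu => exists_B_smul_leftBasis_eq i hu⟩

/-- The integral pairing of the dual lattice with a vector of `Ω`. -/
def pairing (u : Ω) : ΩDual →+ ℤ :=
  AddMonoidHom.mk' (fun y => (y.2.2 u u.2).choose) fun x y => by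
    apply Int.cast_injective (α := ℚ)
    rw [Int.cast_add, ← (x.2.2 u u.2).choose_spec, ← (y.2.2 u u.2).choose_spec,
      ← ((x + y).2.2 u u.2).choose_spec]
    simp [B_eq_toBilin']

theorem cast_pairing (u : Ω) (y : ΩDual) : (pairing u y : ℚ) = B y u :=
  (y.2.2 u u.2).choose_spec.symm

/-- The pairings with `rightBasis`, each taken modulo the corresponding elementary divisor. -/
def toZMods : ΩDual →+ ∀ i, ZMod (elemDiv i) :=
  AddMonoidHom.pi fun i =>
    (Int.castAddHom (ZMod (elemDiv i))).comp (pairing ⟨rightBasis i, rightBasis_mem i⟩)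

theorem toZMods_apply (y : ΩDual) (i : Fin 12) :
    toZMods y i = (pairing ⟨rightBasis i, rightBasis_mem i⟩ y : ZMod (elemDiv i)) :=
  rfl

theorem pairing_dualVec (i j : Fin 12) :
    pairing ⟨rightBasis j, rightBasis_mem j⟩ (dualVec i) = if i = j then 1 else 0 := by
  apply Int.cast_injective (α := ℚ)
  have h : B (dualVec i) (rightBasis j) = (elemDiv i : ℚ)⁻¹ * B (leftBasis i) (rightBasis j) := by
    simp [B_eq_toBilin', dualVec]
  rw [cast_pairing, h, B_left_right]
  split_ifs
  · rw [inv_mul_cancel₀ (elemDiv_ne_zero i), Int.cast_one]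
  · simp

theorem toZMods_surjective : Function.Surjective toZMods := by
  intro f
  choose c hc using fun i => ZMod.intCast_surjective (f i)
  refine ⟨∑ i, c i • dualVec i, funext fun j => ?_⟩
  rw [toZMods_apply, ← hc j]
  simp [map_sum, pairing_dualVec]

theorem ker_toZMods :
    toZMods.ker = (Submodule.comap ΩDual.subtype Ω).toAddSubgroup := by
  ext y
  simp only [AddMonoidHom.mem_ker, Submodule.mem_toAddSubgroup, Submodule.mem_comap,
    Submodule.subtype_apply, funext_iff, toZMods_apply, Pi.zero_apply,
    ZMod.intCast_zmod_eq_zero_iff_dvd]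
  constructor
  · intro h
    choose n hn using h
    rw [eq_sum_leftBasis y.2.1]
    refine Submodule.sum_mem _ fun i _ => ?_
    have hi : B y (rightBasis i) / elemDiv i = n i := by
      rw [← cast_pairing ⟨rightBasis i, rightBasis_mem i⟩, hn i, Int.cast_mul, Int.cast_natCast,
        mul_div_cancel_left₀ _ (elemDiv_ne_zero i)]
    rw [hi, Int.cast_smul_eq_zsmul]
    exact Submodule.smul_mem _ _ (leftBasis_mem i)
  · intro h i
    obtain ⟨n, hn⟩ := exists_B_rightBasis_div_eq h i
    refine ⟨n, Int.cast_injective (α := ℚ) ?_⟩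
    rw [cast_pairing, Int.cast_mul, ← hn, Int.cast_natCast, mul_div_cancel₀ _ (elemDiv_ne_zero i)]

/-- The product of the `ZMod (elemDiv i)` with the trivial factors `ZMod 1` dropped. -/
def zmodsEquiv : (∀ i, ZMod (elemDiv i)) ≃+ (Fin 6 → ZMod 2) × (Fin 2 → ZMod 4) where
  toFun f := (![f 0, f 1, f 2, f 3, f 4, f 5], ![f 6, f 7])
  invFun p := Fin.cons (p.1 0) <| Fin.cons (p.1 1) <| Fin.cons (p.1 2) <| Fin.cons (p.1 3) <|
    Fin.cons (p.1 4) <| Fin.cons (p.1 5) <| Fin.cons (p.2 0) <| Fin.cons (p.2 1) fun _ => 0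
  left_inv f := by
    funext i
    fin_cases i <;> first | rfl | exact Subsingleton.elim (α := ZMod 1) _ _
  right_inv p := by
    refine Prod.ext (funext fun i => ?_) (funext fun i => ?_) <;> fin_cases i <;> rfl
  map_add' f g := by
    refine Prod.ext (funext fun i => ?_) (funext fun i => ?_) <;> fin_cases i <;> rfl

/-- the discriminant group Ω^∨/Ω is isomorphic to (ℤ/2ℤ)^6 × (ℤ/4ℤ)². -/
theorem stmt4 :
    Nonempty ((↥ΩDual ⧸ Submodule.comap ΩDual.subtype Ω)
      ≃+ ((Fin 6 → ZMod 2) × (Fin 2 → ZMod 4))) :=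
  ⟨((QuotientAddGroup.quotientAddEquivOfEq ker_toZMods).symm.trans
    (QuotientAddGroup.quotientKerEquivOfSurjective toZMods toZMods_surjective)).trans zmodsEquiv⟩
end
end

section
/- For all u,v ∈ V one has ⟨P(u),P(v)⟩^ = (1/2)·⟨u+τ(u), v+τ(v)⟩; moreover P(W) = ℤ^14, the lattice spanned by the standard basis of V^. (This realizes the pushforward map π_{τ*} induced in cohomology by the rational quotient map X ⇢ Z̃_τ on the sublattice W of H²(X,ℤ): the image lattice is A_2 ⊕ A_2 ⊕ A_2(2) ⊕ A_2(2) ⊕ A_2 ⊕ U(6) ⊕ [[8,4],[4,8]].) -/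
/- Context: V = ℚ^22 with the Gram matrix of the paper, W = ℤ^22, τ the
involution; V^ = ℚ^14 (the target of π_{τ*}) with its Gram matrix, and
P : V → V^ the pushforward map. -/

noncomputable section
open Matrix

/-- V^ = ℚ^14, coordinates (â₁,â₂,ĉ₁,ĉ₂,ê₁,ê₂,f̂₁,f̂₂,ĝ₁,ĝ₂,x̂,ŷ,v̂₁,v̂₂). -/
abbrev Vh : Type := Fin 14 → ℚ

/-- Gram matrix of V^: blocks [[-2,1],[1,-2]] on (0,1),(2,3),(8,9);
[[-4,2],[2,-4]] on (4,5),(6,7); [[0,6],[6,0]] on (10,11); [[8,4],[4,8]] on (12,13). -/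
def gramH : Matrix (Fin 14) (Fin 14) ℚ := Matrix.of fun i j =>
  if i = j then
    (if i.val < 4 then -2 else if i.val < 8 then -4 else if i.val < 10 then -2
     else if i.val < 12 then 0 else 8)
  else if i.val / 2 = j.val / 2 then
    (if i.val < 4 then 1 else if i.val < 8 then 2 else if i.val < 10 then 1
     else if i.val < 12 then 6 else 4)
  else 0

def Bh (u v : Vh) : ℚ := u ⬝ᵥ (gramH *ᵥ v)

/-- The pushforward π_{τ*} on W : a_i,b_i ↦ â_i; c_i,d_i ↦ ĉ_i; e_i ↦ ê_i;
f_i ↦ f̂_i; g_i,h_i ↦ ĝ_i; z,w ↦ 0; x ↦ x̂; y ↦ ŷ; v_i ↦ v̂_i. -/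
def P : V → Vh := fun u =>
  ![u 0 + u 2, u 1 + u 3, u 4 + u 6, u 5 + u 7, u 8, u 9, u 10, u 11,
    u 12 + u 14, u 13 + u 15, u 18, u 19, u 20, u 21]

theorem B_eq (u v : V) :
    B u v =
      u 0 * (-2 * v 0 + v 1) + u 1 * (v 0 - 2 * v 1) +
      u 2 * (-2 * v 2 + v 3) + u 3 * (v 2 - 2 * v 3) +
      u 4 * (-2 * v 4 + v 5) + u 5 * (v 4 - 2 * v 5) +
      u 6 * (-2 * v 6 + v 7) + u 7 * (v 6 - 2 * v 7) +
      u 8 * (-2 * v 8 + v 9) + u 9 * (v 8 - 2 * v 9) +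
      u 10 * (-2 * v 10 + v 11) + u 11 * (v 10 - 2 * v 11) +
      u 12 * (-2 * v 12 + v 13) + u 13 * (v 12 - 2 * v 13) +
      u 14 * (-2 * v 14 + v 15) + u 15 * (v 14 - 2 * v 15) +
      u 16 * (-4 * v 16 + 2 * v 17) + u 17 * (2 * v 16 - 4 * v 17) +
      u 18 * (3 * v 19) + u 19 * (3 * v 18) +
      u 20 * (4 * v 20 + 2 * v 21) + u 21 * (2 * v 20 + 4 * v 21) := by
  simp [B, dotProduct, mulVec, gramX, Fin.sum_univ_succ]
  ring

theorem Bh_eq (u v : Vh) :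
    Bh u v =
      u 0 * (-2 * v 0 + v 1) + u 1 * (v 0 - 2 * v 1) +
      u 2 * (-2 * v 2 + v 3) + u 3 * (v 2 - 2 * v 3) +
      u 4 * (-4 * v 4 + 2 * v 5) + u 5 * (2 * v 4 - 4 * v 5) +
      u 6 * (-4 * v 6 + 2 * v 7) + u 7 * (2 * v 6 - 4 * v 7) +
      u 8 * (-2 * v 8 + v 9) + u 9 * (v 8 - 2 * v 9) +
      u 10 * (6 * v 11) + u 11 * (6 * v 10) +
      u 12 * (8 * v 12 + 4 * v 13) + u 13 * (4 * v 12 + 8 * v 13) := by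
  simp [Bh, dotProduct, mulVec, gramH, Fin.sum_univ_succ]
  ring

/-- A section of `P`, with zero coordinates at `b_i`, `d_i`, `h_i`, `z` and `w`. -/
def sectionP (y : Vh) : V :=
  ![y 0, y 1, 0, 0, y 2, y 3, 0, 0, y 4, y 5, y 6, y 7, y 8, y 9, 0, 0, 0, 0,
    y 10, y 11, y 12, y 13]

theorem P_sectionP (y : Vh) : P (sectionP y) = y := by
  funext i
  fin_cases i <;> simp [P, sectionP]

theorem sectionP_mem_W {y : Vh} (hy : ∀ i, ∃ n : ℤ, y i = (n : ℚ)) : sectionP y ∈ W := by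
  have h0 : ∃ n : ℤ, (0 : ℚ) = n := ⟨0, by simp⟩
  intro i
  fin_cases i <;> first | exact hy _ | exact h0

theorem P_mem_of_mem_W {u : V} (hu : u ∈ W) (i : Fin 14) : ∃ n : ℤ, P u i = (n : ℚ) := by
  have hadd (j k : Fin 22) : ∃ n : ℤ, u j + u k = (n : ℚ) := by
    obtain ⟨m, hm⟩ := hu j
    obtain ⟨n, hn⟩ := hu k
    exact ⟨m + n, by rw [hm, hn, Int.cast_add]⟩
  fin_cases i <;> first | exact hadd _ _ | exact hu _

/-- the push-pull formula ⟨P u, P v⟩^ = ½⟨u+τu, v+τv⟩, and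
P(W) is the standard lattice ℤ^14 of V^. -/
theorem stmt5 :
    (∀ u v : V, Bh (P u) (P v) = (1/2 : ℚ) * B (u + tau u) (v + tau v)) ∧
    P '' W = {u : Vh | ∀ i, ∃ n : ℤ, u i = (n : ℚ)} := by
  refine ⟨fun u v => ?_, Set.Subset.antisymm ?_ ?_⟩
  · rw [B_eq, Bh_eq]
    simp [P, tau, tauSign, tauIdx]
    ring
  · rintro _ ⟨u, hu, rfl⟩
    exact P_mem_of_mem_W hu
  · intro y hy
    exact ⟨sectionP y, sectionP_mem_W hy, P_sectionP y⟩
end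
end

section
/- The map φ^ is an involution preserving the bilinear form of V' and mapping the standard lattice ℤ^22 onto itself, and for all u,v ∈ V' one has ⟨R(u),R(v)⟩¯ = (1/2)·⟨u+φ^(u), v+φ^(v)⟩'. (This realizes the pushforward along the residual involution φ^ on Z̃_τ, whose action on the exceptional classes is forced to be n_1↔n_8, n_2↔n_5, n_3↔n_7, n_4↔n_6 by integrality of the image lattice.) -/
/- Context: V' = ℚ^22 = H²(Z̃_τ)-sublattice with coordinates
(â₁,â₂,ĉ₁,ĉ₂,ê₁,ê₂,f̂₁,f̂₂,ĝ₁,ĝ₂,x̂,ŷ,v̂₁,v̂₂,n₁,…,n₈) (indices 0,…,21),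
φ^ the residual involution, V¯ = ℚ^14 the target of the pushforward R. -/

noncomputable section
open Matrix

abbrev V' : Type := Fin 22 → ℚ

/-- Gram matrix of V': [[-2,1],[1,-2]] on (0,1),(2,3),(8,9);
[[-4,2],[2,-4]] on (4,5),(6,7); [[0,6],[6,0]] on (10,11);
[[8,4],[4,8]] on (12,13); -2·Id on 14,…,21. -/
def gramP : Matrix (Fin 22) (Fin 22) ℚ := Matrix.of fun i j =>
  if 14 ≤ i.val ∨ 14 ≤ j.val then (if i = j then -2 else 0)
  else if i = j then
    (if i.val < 4 then -2 else if i.val < 8 then -4 else if i.val < 10 then -2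
     else if i.val < 12 then 0 else 8)
  else if i.val / 2 = j.val / 2 then
    (if i.val < 4 then 1 else if i.val < 8 then 2 else if i.val < 10 then 1
     else if i.val < 12 then 6 else 4)
  else 0

def B' (u v : V') : ℚ := u ⬝ᵥ (gramP *ᵥ v)

def phiHatIdx : Fin 22 → Fin 22 :=
  ![2,3,0,1,6,7,4,5,8,9,10,11,12,13,21,18,20,19,15,17,16,14]

/-- φ^ : swaps â_i↔ĉ_i, ê_i↔f̂_i, n₁↔n₈, n₂↔n₅, n₃↔n₇, n₄↔n₆;
fixes ĝ₁,ĝ₂,x̂,ŷ,v̂₁,v̂₂. -/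
def phiHat : V' → V' := fun u i => u (phiHatIdx i)

def W' : Set V' := {u | ∀ i, ∃ n : ℤ, u i = (n : ℚ)}

/-- V¯ = ℚ^14 with coordinates (ā₁,ā₂,ē₁,ē₂,ḡ₁,ḡ₂,x̄,ȳ,v̄₁,v̄₂,n̄₁,…,n̄₄). -/
abbrev Vb : Type := Fin 14 → ℚ

/-- Gram matrix of V¯: [[-2,1],[1,-2]] on (0,1); [[-4,2],[2,-4]] on (2,3),(4,5);
[[0,12],[12,0]] on (6,7); [[16,8],[8,16]] on (8,9); -2·Id on 10,…,13. -/
def gramB : Matrix (Fin 14) (Fin 14) ℚ := Matrix.of fun i j =>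
  if 10 ≤ i.val ∨ 10 ≤ j.val then (if i = j then -2 else 0)
  else if i = j then
    (if i.val < 2 then -2 else if i.val < 6 then -4 else if i.val < 8 then 0 else 16)
  else if i.val / 2 = j.val / 2 then
    (if i.val < 2 then 1 else if i.val < 6 then 2 else if i.val < 8 then 12 else 8)
  else 0

def Bb (u v : Vb) : ℚ := u ⬝ᵥ (gramB *ᵥ v)

/-- The pushforward map R = (π̂_φ)_* : â_i,ĉ_i ↦ ā_i; ê_i,f̂_i ↦ ē_i; ĝ_i ↦ ḡ_i;
x̂ ↦ x̄; ŷ ↦ ȳ; v̂_i ↦ v̄_i; n₁,n₈ ↦ n̄₁; n₂,n₅ ↦ n̄₂; n₃,n₇ ↦ n̄₃; n₄,n₆ ↦ n̄₄. -/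
def R : V' → Vb := fun u =>
  ![u 0 + u 2, u 1 + u 3, u 4 + u 6, u 5 + u 7, u 8, u 9, u 10, u 11, u 12, u 13,
    u 14 + u 21, u 15 + u 18, u 16 + u 20, u 17 + u 19]

theorem gramP_mulVec (v : V') : gramP *ᵥ v =
    ![-2 * v 0 + 1 * v 1, 1 * v 0 + -2 * v 1, -2 * v 2 + 1 * v 3, 1 * v 2 + -2 * v 3,
    -4 * v 4 + 2 * v 5, 2 * v 4 + -4 * v 5, -4 * v 6 + 2 * v 7, 2 * v 6 + -4 * v 7,
    -2 * v 8 + 1 * v 9, 1 * v 8 + -2 * v 9, 6 * v 11, 6 * v 10,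
    8 * v 12 + 4 * v 13, 4 * v 12 + 8 * v 13, -2 * v 14, -2 * v 15,
    -2 * v 16, -2 * v 17, -2 * v 18, -2 * v 19,
    -2 * v 20, -2 * v 21] := by
  ext i
  fin_cases i <;>
    simp [gramP, Matrix.mulVec, dotProduct, Fin.sum_univ_succ]

theorem B'_eq (u v : V') : B' u v =
    -2 * (u 0 * v 0 + u 1 * v 1) + 1 * (u 0 * v 1 + u 1 * v 0) +
    -2 * (u 2 * v 2 + u 3 * v 3) + 1 * (u 2 * v 3 + u 3 * v 2) +
    -4 * (u 4 * v 4 + u 5 * v 5) + 2 * (u 4 * v 5 + u 5 * v 4) +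
    -4 * (u 6 * v 6 + u 7 * v 7) + 2 * (u 6 * v 7 + u 7 * v 6) +
    -2 * (u 8 * v 8 + u 9 * v 9) + 1 * (u 8 * v 9 + u 9 * v 8) +
    6 * (u 10 * v 11 + u 11 * v 10) +
    8 * (u 12 * v 12 + u 13 * v 13) + 4 * (u 12 * v 13 + u 13 * v 12) +
    -2 * (u 14 * v 14 + u 15 * v 15 + u 16 * v 16 + u 17 * v 17 +
      u 18 * v 18 + u 19 * v 19 + u 20 * v 20 + u 21 * v 21) := by
  rw [B', gramP_mulVec]
  simp [dotProduct, Fin.sum_univ_succ]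
  ring

theorem gramB_mulVec (v : Vb) : gramB *ᵥ v =
    ![-2 * v 0 + 1 * v 1, 1 * v 0 + -2 * v 1, -4 * v 2 + 2 * v 3, 2 * v 2 + -4 * v 3,
    -4 * v 4 + 2 * v 5, 2 * v 4 + -4 * v 5, 12 * v 7, 12 * v 6,
    16 * v 8 + 8 * v 9, 8 * v 8 + 16 * v 9, -2 * v 10, -2 * v 11,
    -2 * v 12, -2 * v 13] := by
  ext i
  fin_cases i <;>
    simp [gramB, Matrix.mulVec, dotProduct, Fin.sum_univ_succ]

theorem Bb_eq (u v : Vb) : Bb u v =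
    -2 * (u 0 * v 0 + u 1 * v 1) + 1 * (u 0 * v 1 + u 1 * v 0) +
    -4 * (u 2 * v 2 + u 3 * v 3) + 2 * (u 2 * v 3 + u 3 * v 2) +
    -4 * (u 4 * v 4 + u 5 * v 5) + 2 * (u 4 * v 5 + u 5 * v 4) +
    12 * (u 6 * v 7 + u 7 * v 6) +
    16 * (u 8 * v 8 + u 9 * v 9) + 8 * (u 8 * v 9 + u 9 * v 8) +
    -2 * (u 10 * v 10 + u 11 * v 11 + u 12 * v 12 + u 13 * v 13) := by
  rw [Bb, gramB_mulVec]
  simp [dotProduct, Fin.sum_univ_succ]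
  ring

theorem phiHatIdx_involutive : Function.Involutive phiHatIdx := by
  unfold Function.Involutive
  decide

theorem phiHat_comp_phiHat : phiHat ∘ phiHat = id := by
  ext u i
  exact congrArg u (phiHatIdx_involutive i)

theorem phiHat_mem_W' {u : V'} (hu : u ∈ W') : phiHat u ∈ W' := fun i => hu (phiHatIdx i)

/-- φ^ is an involutive isometry of V' preserving ℤ^22, and the
push-pull formula ⟨R u, R v⟩¯ = ½⟨u+φ^u, v+φ^v⟩' holds. -/
theorem stmt10 :
    phiHat ∘ phiHat = id ∧
    (∀ u v : V', B' (phiHat u) (phiHat v) = B' u v) ∧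
    phiHat '' W' = W' ∧
    (∀ u v : V', Bb (R u) (R v) = (1/2 : ℚ) * B' (u + phiHat u) (v + phiHat v)) := by
  refine ⟨phiHat_comp_phiHat, fun u v => ?_, ?_, fun u v => ?_⟩
  · simp only [B'_eq, phiHat, phiHatIdx, Matrix.cons_val]
    ring
  · exact Set.Subset.antisymm (Set.image_subset_iff.2 fun u hu => phiHat_mem_W' hu) fun u hu =>
      ⟨phiHat u, phiHat_mem_W' hu, congrFun phiHat_comp_phiHat u⟩
  · simp only [Bb_eq, B'_eq, R, phiHat, phiHatIdx, Pi.add_apply, Matrix.cons_val]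
    ring
end
end
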